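/- There is a surjective ℤ-algebra homomorphism Φ : ℤ𝔖_n → TL_n with Φ(s_i) = u_i − 1 for every simple transposition s_i = (i, i+1), 1 ≤ i ≤ n−1. Moreover, for n ≥ 3 the kernel of Φ is the two-sided ideal of ℤ𝔖_n generated by the single element s_1 s_2 s_1 + s_1 s_2 + s_2 s_1 + s_1 + s_2 + 1. -/

import Mathlib

/-- Relations defining the Temperley–Lieb algebra with loop parameter `2`,
on generators `u_1, …, u_{n-1}` (indexed by `Fin (n-1)`). -/
inductive TLRel (R : Type) [CommRing R] (n : ℕ) :
    FreeAlgebra R (Fin (n - 1)) → FreeAlgebra R (Fin (n - 1)) → Prop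
  | sq (i : Fin (n - 1)) :
      TLRel R n (FreeAlgebra.ι R i * FreeAlgebra.ι R i) (2 * FreeAlgebra.ι R i)
  | braid (i j : Fin (n - 1)) (h : Nat.dist i.val j.val = 1) :
      TLRel R n (FreeAlgebra.ι R i * FreeAlgebra.ι R j * FreeAlgebra.ι R i) (FreeAlgebra.ι R i)
  | comm (i j : Fin (n - 1)) (h : 1 < Nat.dist i.val j.val) :
      TLRel R n (FreeAlgebra.ι R i * FreeAlgebra.ι R j) (FreeAlgebra.ι R j * FreeAlgebra.ι R i)

/-- The Temperley–Lieb algebra `TL_n` over `R`, with loop parameter `2`. -/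
abbrev TL (R : Type) [CommRing R] (n : ℕ) : Type := RingQuot (TLRel R n)

/-- The generator `u_{i+1}` of the Temperley–Lieb algebra. -/
noncomputable def TLu (R : Type) [CommRing R] (n : ℕ) (i : Fin (n - 1)) : TL R n :=
  RingQuot.mkAlgHom R (TLRel R n) (FreeAlgebra.ι R i)


/-- The group algebra `R𝔖_n` of the symmetric group on `{1, …, n}`. -/
abbrev SymGrpAlg (R : Type) [CommRing R] (n : ℕ) : Type := MonoidAlgebra R (Equiv.Perm (Fin n))

/-- The simple transposition `s_{i+1} = (i+1, i+2)` (1-based) in `𝔖_n`, for `i : Fin (n-1)`. -/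
def simpleT (n : ℕ) (i : Fin (n - 1)) : Equiv.Perm (Fin n) :=
  Equiv.swap ⟨i.val, by have := i.isLt; omega⟩ ⟨i.val + 1, by have := i.isLt; omega⟩

/-- The descending word `t n * t (n - 1) * ⋯` of length `m`. -/
def descWord {M : Type*} [Monoid M] (t : ℕ → M) (n : ℕ) : ℕ → M
  | 0 => 1
  | m + 1 => descWord t n m * t (n - m)

section Braid

variable {M : Type*} [Monoid M] {t : ℕ → M}

theorem descWord_mul_of_lt (comm : ∀ i j, i + 1 < j → t i * t j = t j * t i) {n i : ℕ} :
    ∀ m, i + m < n → descWord t n m * t i = t i * descWord t n m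
  | 0, _ => by simp [descWord]
  | m + 1, h => by
    rw [descWord, mul_assoc, ← comm i (n - m) (by omega), ← mul_assoc,
      descWord_mul_of_lt comm m (by omega), mul_assoc]

theorem descWord_mul_of_gt (comm : ∀ i j, i + 1 < j → t i * t j = t j * t i) {n j : ℕ}
    (braid : ∀ i, i + 1 < n + 1 → t i * t (i + 1) * t i = t (i + 1) * t i * t (i + 1))
    (hj : j + 1 ≤ n) :
    ∀ m, n < j + m → m ≤ n + 1 → descWord t n m * t (j + 1) = t j * descWord t n m
  | 0, h, _ => by omega
  | p + 1, h, hp => by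
    obtain h' | h' := Nat.lt_or_ge n (j + p)
    · rw [descWord, mul_assoc, comm (n - p) (j + 1) (by omega), ← mul_assoc,
        descWord_mul_of_gt comm braid hj p h' (by omega), mul_assoc]
    · obtain ⟨q, rfl⟩ : ∃ q, p = q + 1 := ⟨p - 1, by omega⟩
      rw [descWord, descWord, show n - (q + 1) = j by omega, show n - q = j + 1 by omega,
        mul_assoc (descWord t n q), mul_assoc (descWord t n q), ← braid j (by omega),
        mul_assoc (t j), ← mul_assoc, descWord_mul_of_lt comm q (by omega)]
      simp only [mul_assoc]

theorem exists_descWord_mul_eq (sq : ∀ i, t i * t i = 1)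
    (comm : ∀ i j, i + 1 < j → t i * t j = t j * t i) {n i m : ℕ}
    (braid : ∀ i, i + 1 < n + 1 → t i * t (i + 1) * t i = t (i + 1) * t i * t (i + 1))
    (hi : i < n + 1) (hm : m < n + 2) :
    ∃ h ∈ Submonoid.closure (t '' Set.Iio n), ∃ k < n + 2,
      descWord t n m * t i = h * descWord t n k := by
  obtain h | h | h | h : i + m = n ∨ i + m = n + 1 ∨ i + m < n ∨ n + 1 < i + m := by omega
  · refine ⟨1, one_mem _, m + 1, by omega, ?_⟩
    rw [descWord, one_mul, ← h, Nat.add_sub_cancel]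
  · obtain ⟨p, rfl⟩ : ∃ p, m = p + 1 := ⟨m - 1, by omega⟩
    refine ⟨1, one_mem _, p, by omega, ?_⟩
    rw [descWord, show n - p = i by omega, mul_assoc, sq, mul_one, one_mul]
  · exact ⟨t i, Submonoid.subset_closure ⟨i, by simp; omega, rfl⟩, m, hm,
      descWord_mul_of_lt comm m h⟩
  · obtain ⟨j, rfl⟩ : ∃ j, i = j + 1 := ⟨i - 1, by omega⟩
    exact ⟨t j, Submonoid.subset_closure ⟨j, by simp; omega, rfl⟩, m, hm,
      descWord_mul_of_gt comm braid (by omega) m (by omega) (by omega)⟩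

/-- A monoid generated by `n` elements satisfying the Coxeter relations of type `A`
has at most `(n + 1)!` elements. -/
theorem exists_finset_card_le_factorial (sq : ∀ i, t i * t i = 1)
    (comm : ∀ i j, i + 1 < j → t i * t j = t j * t i) (n : ℕ)
    (braid : ∀ i, i + 1 < n → t i * t (i + 1) * t i = t (i + 1) * t i * t (i + 1)) :
    ∃ F : Finset M, F.card ≤ (n + 1).factorial ∧ ∀ x ∈ Submonoid.closure (t '' Set.Iio n), x ∈ F := by
  classical
  induction n with
  | zero => exact ⟨{1}, by simp, by simp⟩
  | succ n ih =>
    obtain ⟨F, hF, hmem⟩ := ih fun i hi => braid i (by omega)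
    refine ⟨Finset.image₂ (· * ·) F ((Finset.range (n + 2)).image (descWord t n)), ?_, ?_⟩
    · refine (Finset.card_image₂_le _ _ _).trans ?_
      rw [Nat.factorial_succ (n + 1), mul_comm]
      exact Nat.mul_le_mul (Finset.card_image_le.trans (by simp)) hF
    · suffices H : ∀ x ∈ Submonoid.closure (t '' Set.Iio (n + 1)),
          ∃ h ∈ Submonoid.closure (t '' Set.Iio n), ∃ k < n + 2, x = h * descWord t n k by
        intro x hx
        obtain ⟨h, hh, k, hk, rfl⟩ := H x hx
        exact Finset.mem_image₂_of_mem (hmem h hh)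
          (Finset.mem_image_of_mem _ (Finset.mem_range.2 hk))
      intro x hx
      induction hx using Submonoid.closure_induction_right with
      | one => exact ⟨1, one_mem _, 0, by omega, by simp [descWord]⟩
      | mul_right x hx y hy ih =>
        obtain ⟨i, hi, rfl⟩ := hy
        obtain ⟨h, hh, k, hk, rfl⟩ := ih
        obtain ⟨h', hh', k', hk', e⟩ := exists_descWord_mul_eq sq comm braid hi hk
        exact ⟨h * h', mul_mem hh hh', k', hk', by rw [mul_assoc, e, mul_assoc]⟩

end Braid

theorem simpleT_mul_self (n : ℕ) (i : Fin (n - 1)) : simpleT n i * simpleT n i = 1 :=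
  Equiv.swap_mul_self _ _

theorem simpleT_comm {n : ℕ} {i j : Fin (n - 1)} (h : i.val + 1 < j.val) :
    simpleT n i * simpleT n j = simpleT n j * simpleT n i := by
  have hj := j.isLt
  conv_lhs => rw [simpleT, simpleT, Equiv.mul_swap_eq_swap_mul]
  rw [Equiv.swap_apply_of_ne_of_ne, Equiv.swap_apply_of_ne_of_ne, simpleT, simpleT] <;>
  · simp only [ne_eq, Fin.mk.injEq]
    omega

theorem Equiv.swap_mul_swap_mul_swap_braid {α : Type*} [DecidableEq α] {a b c : α}
    (hab : a ≠ b) (hac : a ≠ c) (hbc : b ≠ c) :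
    swap a b * swap b c * swap a b = swap b c * swap a b * swap b c := by
  rw [mul_swap_eq_swap_mul (swap a b * swap b c), Perm.mul_apply, Perm.mul_apply,
    swap_apply_left b c, swap_apply_of_ne_of_ne hab hac, swap_apply_left,
    swap_apply_of_ne_of_ne hac.symm hbc.symm, mul_assoc]

theorem simpleT_braid {n : ℕ} {i j : Fin (n - 1)} (h : i.val + 1 = j.val) :
    simpleT n i * simpleT n j * simpleT n i = simpleT n j * simpleT n i * simpleT n j := by
  obtain ⟨i, hi⟩ := i
  obtain ⟨j, hj⟩ := j
  obtain rfl : i + 1 = j := h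
  exact Equiv.swap_mul_swap_mul_swap_braid (by simp) (by simp; omega) (by simp)

theorem closure_range_simpleT (n : ℕ) : Submonoid.closure (Set.range (simpleT n)) = ⊤ := by
  cases n with
  | zero => exact Subsingleton.elim _ _
  | succ m => exact Equiv.Perm.mclosure_swap_castSucc_succ m

/-- The Coxeter presentation of the symmetric group: elements of a monoid satisfying the Coxeter
relations of type `A` are the images of the simple transpositions under a homomorphism. -/
theorem exists_monoidHom_simpleT {M : Type*} [Monoid M] {n : ℕ} (t : Fin (n - 1) → M)
    (sq : ∀ i, t i * t i = 1)
    (comm : ∀ i j : Fin (n - 1), i.val + 1 < j.val → t i * t j = t j * t i)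
    (braid : ∀ i j : Fin (n - 1), i.val + 1 = j.val → t i * t j * t i = t j * t i * t j) :
    ∃ f : Equiv.Perm (Fin n) →* M, ∀ i, f (simpleT n i) = t i := by
  let T : ℕ → M × Equiv.Perm (Fin n) := fun i =>
    if h : i < n - 1 then (t ⟨i, h⟩, simpleT n ⟨i, h⟩) else 1
  have hT (i : Fin (n - 1)) : T i = (t i, simpleT n i) := dif_pos i.isLt
  have Tsq (i : ℕ) : T i * T i = 1 := by
    by_cases h : i < n - 1
    · simp [T, h, sq, simpleT_mul_self]
    · simp [T, h]
  have Tcomm (i j : ℕ) (hij : i + 1 < j) : T i * T j = T j * T i := by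
    by_cases hj : j < n - 1
    · have hi : i < n - 1 := by omega
      simp only [T, hi, hj, dif_pos, Prod.mk_mul_mk]
      rw [comm ⟨i, hi⟩ ⟨j, hj⟩ hij, simpleT_comm (i := ⟨i, hi⟩) (j := ⟨j, hj⟩) hij]
    · simp [T, hj]
  have Tbraid (i : ℕ) (hij : i + 1 < n - 1) :
      T i * T (i + 1) * T i = T (i + 1) * T i * T (i + 1) := by
    have hi : i < n - 1 := by omega
    simp only [T, hi, hij, dif_pos, Prod.mk_mul_mk]
    rw [braid ⟨i, hi⟩ ⟨i + 1, hij⟩ rfl, simpleT_braid (i := ⟨i, hi⟩) (j := ⟨i + 1, hij⟩) rfl]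
  obtain ⟨F, hF, hmem⟩ := exists_finset_card_le_factorial Tsq Tcomm (n - 1) Tbraid
  set Γ := Submonoid.closure (T '' Set.Iio (n - 1))
  have mem (i : Fin (n - 1)) : (t i, simpleT n i) ∈ Γ :=
    Submonoid.subset_closure ⟨i, i.isLt, hT i⟩
  let p : Γ →* Equiv.Perm (Fin n) := (MonoidHom.snd M _).comp Γ.subtype
  have hsurj : Function.Surjective p := by
    rw [← MonoidHom.mrange_eq_top, eq_top_iff, ← closure_range_simpleT, Submonoid.closure_le]
    rintro _ ⟨i, rfl⟩
    exact ⟨⟨_, mem i⟩, rfl⟩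
  let incl : Γ → F := fun x => ⟨x, hmem _ x.2⟩
  have hincl : Function.Injective incl := fun x y h =>
    Subtype.ext (Subtype.mk.inj h)
  have : Finite Γ := Finite.of_injective incl hincl
  have hcard : Nat.card Γ ≤ Nat.card (Equiv.Perm (Fin n)) := by
    refine (Nat.card_le_card_of_injective incl hincl).trans ?_
    rw [Nat.card_eq_finsetCard, Nat.card_perm, Nat.card_fin]
    refine hF.trans ?_
    cases n <;> simp
  have hbij : Function.Bijective p := (Nat.bijective_iff_surjective_and_card p).2
    ⟨hsurj, hcard.antisymm (Nat.card_le_card_of_surjective p hsurj)⟩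
  let e := MulEquiv.ofBijective p hbij
  refine ⟨((MonoidHom.fst M _).comp Γ.subtype).comp e.symm.toMonoidHom, fun i => ?_⟩
  have : e.symm (simpleT n i) = ⟨_, mem i⟩ := by
    rw [MulEquiv.symm_apply_eq]
    rfl
  simp [this]

theorem sub_one_mul_self_eq_one {A : Type*} [Ring A] {u : A} (hu : u * u = 2 * u) :
    (u - 1) * (u - 1) = 1 := by
  calc (u - 1) * (u - 1) = u * u - 2 * u + 1 := by noncomm_ring
    _ = 1 := by rw [hu, sub_self, zero_add]

theorem sub_one_braid {A : Type*} [Ring A] {u v : A} (hu : u * u = 2 * u) (hv : v * v = 2 * v)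
    (huv : u * v * u = u) (hvu : v * u * v = v) :
    (u - 1) * (v - 1) * (u - 1) = (v - 1) * (u - 1) * (v - 1) := by
  have key {x y : A} (hx : x * x = 2 * x) (hxy : x * y * x = x) :
      (x - 1) * (y - 1) * (x - 1) = x + y - x * y - y * x - 1 := by
    calc (x - 1) * (y - 1) * (x - 1) = x * y * x - x * x + 2 * x + y - x * y - y * x - 1 := by
          noncomm_ring
      _ = _ := by rw [hxy, hx]; noncomm_ring
  rw [key hu huv, key hv hvu]
  abel

section TL

variable {R : Type} [CommRing R] {n : ℕ}

theorem TLu_mul_self (i : Fin (n - 1)) : TLu R n i * TLu R n i = 2 * TLu R n i := by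
  simpa [TLu, map_ofNat] using RingQuot.mkAlgHom_rel R (TLRel.sq (R := R) (n := n) i)

theorem TLu_braid {i j : Fin (n - 1)} (h : Nat.dist i.val j.val = 1) :
    TLu R n i * TLu R n j * TLu R n i = TLu R n i := by
  simpa [TLu] using RingQuot.mkAlgHom_rel R (TLRel.braid (R := R) (n := n) i j h)

theorem TLu_comm {i j : Fin (n - 1)} (h : 1 < Nat.dist i.val j.val) :
    TLu R n i * TLu R n j = TLu R n j * TLu R n i := by
  simpa [TLu] using RingQuot.mkAlgHom_rel R (TLRel.comm (R := R) (n := n) i j h)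

variable (R n) in
theorem adjoin_range_TLu : Algebra.adjoin R (Set.range (TLu R n)) = ⊤ := by
  have h : Set.range (TLu R n) =
      RingQuot.mkAlgHom R (TLRel R n) '' Set.range (FreeAlgebra.ι R) := by
    rw [← Set.range_comp]
    rfl
  rw [h, ← AlgHom.map_adjoin, FreeAlgebra.adjoin_range_ι, Algebra.map_top,
    AlgHom.range_eq_top]
  exact RingQuot.mkAlgHom_surjective R _

/-- Elements satisfying the Temperley–Lieb relations are the images of the generators
under an algebra homomorphism. -/
theorem exists_algHom_TLu {A : Type*} [Ring A] [Algebra R A] (v : Fin (n - 1) → A)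
    (sq : ∀ i, v i * v i = 2 * v i)
    (braid : ∀ i j : Fin (n - 1), Nat.dist i.val j.val = 1 → v i * v j * v i = v i)
    (comm : ∀ i j : Fin (n - 1), 1 < Nat.dist i.val j.val → v i * v j = v j * v i) :
    ∃ f : TL R n →ₐ[R] A, ∀ i, f (TLu R n i) = v i := by
  have hv ⦃x y⦄ (h : TLRel R n x y) : FreeAlgebra.lift R v x = FreeAlgebra.lift R v y := by
    obtain i | ⟨i, j, h⟩ | ⟨i, j, h⟩ := h
    · simpa [map_ofNat] using sq i
    · simpa using braid i j h
    · simpa using comm i j h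
  exact ⟨RingQuot.liftAlgHom R ⟨FreeAlgebra.lift R v, hv⟩, fun i => by
    rw [TLu, RingQuot.liftAlgHom_mkAlgHom_apply, FreeAlgebra.lift_ι_apply]⟩

variable (R n) in
/-- The algebra homomorphism from the group algebra of the symmetric group to the
Temperley–Lieb algebra with `s_i ↦ u_i - 1`. -/
theorem exists_algHom_simpleT : ∃ Φ : SymGrpAlg R n →ₐ[R] TL R n,
    ∀ i, Φ (MonoidAlgebra.of R _ (simpleT n i)) = TLu R n i - 1 := by
  suffices h : ∃ f : Equiv.Perm (Fin n) →* TL R n, ∀ i, f (simpleT n i) = TLu R n i - 1 by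
    obtain ⟨f, hf⟩ := h
    exact ⟨MonoidAlgebra.lift R _ _ f, fun i => by simp [hf]⟩
  refine exists_monoidHom_simpleT (fun i => TLu R n i - 1) (fun i => ?_)
    (fun i j h => ?_) (fun i j h => ?_)
  · exact sub_one_mul_self_eq_one (TLu_mul_self i)
  · have := TLu_comm (R := R) (i := i) (j := j) (by rw [Nat.dist]; omega)
    exact ((Commute.sub_right this (Commute.one_right _)).sub_left (Commute.one_left _)).eq
  · exact sub_one_braid (TLu_mul_self i) (TLu_mul_self j)
      (TLu_braid (by rw [Nat.dist]; omega)) (TLu_braid (by rw [Nat.dist]; omega))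

theorem surjective_of_simpleT {Φ : SymGrpAlg R n →ₐ[R] TL R n}
    (hΦ : ∀ i, Φ (MonoidAlgebra.of R _ (simpleT n i)) = TLu R n i - 1) :
    Function.Surjective Φ := by
  rw [← AlgHom.range_eq_top, eq_top_iff, ← adjoin_range_TLu, Algebra.adjoin_le_iff]
  rintro _ ⟨i, rfl⟩
  exact ⟨MonoidAlgebra.of R _ (simpleT n i) + 1, by simp [-MonoidAlgebra.of_apply, hΦ]⟩

end TL

/-- Any two consecutive simple transpositions are simultaneously conjugate to any other two. -/
theorem exists_conj_simpleT {n : ℕ} {i j k l : Fin (n - 1)} (hij : i.val + 1 = j.val)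
    (hkl : k.val + 1 = l.val) :
    ∃ σ : Equiv.Perm (Fin n),
      simpleT n k = σ * simpleT n i * σ⁻¹ ∧ simpleT n l = σ * simpleT n j * σ⁻¹ := by
  have hi : i.val + 1 < n - 1 := by omega
  have hk : k.val + 1 < n - 1 := by omega
  let x (i : Fin (n - 1)) (hi : i.val + 1 < n - 1) (a : Fin 3) : Fin n := ⟨i + a, by omega⟩
  have hx i hi : Function.Injective (x i hi) := fun a b h => by
    simpa [x, Fin.ext_iff] using h
  obtain ⟨σ, hσ⟩ := Equiv.Perm.exists_extending_pair (x i hi) (x k hk) (hx i hi) (hx k hk)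
  refine ⟨σ, ?_, ?_⟩
  · rw [simpleT, simpleT, ← Equiv.swap_apply_apply]
    exact congrArg₂ _ (hσ 0).symm (hσ 1).symm
  · rw [simpleT, simpleT, ← Equiv.swap_apply_apply]
    simp only [← hij, ← hkl]
    exact congrArg₂ _ (hσ 1).symm (hσ 2).symm

/-- The sum `sts + st + ts + s + t + 1`, which for consecutive simple transpositions is the sum
of all elements of the subgroup `𝔖_3` they generate. -/
def braidSum {A : Type*} [Ring A] (s t : A) : A := s * t * s + s * t + t * s + s + t + 1

theorem map_braidSum {A B F : Type*} [Ring A] [Ring B] [FunLike F A B] [RingHomClass F A B]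
    (f : F) (s t : A) : f (braidSum s t) = braidSum (f s) (f t) := by
  simp [braidSum]

theorem braidSum_sub_one {A : Type*} [Ring A] {u v : A} (hu : u * u = 2 * u)
    (huv : u * v * u = u) : braidSum (u - 1) (v - 1) = 0 := by
  calc braidSum (u - 1) (v - 1) = u * v * u - u * u + u := by
        rw [braidSum]; noncomm_ring
    _ = 0 := by rw [hu, huv]; noncomm_ring

theorem add_one_mul_mul_of_braidSum_eq_zero {A : Type*} [Ring A] {s t : A} (hs : s * s = 1)
    (h : braidSum s t = 0) : (s + 1) * (t + 1) * (s + 1) = s + 1 := by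
  calc (s + 1) * (t + 1) * (s + 1) = braidSum s t + s * s + s := by rw [braidSum]; noncomm_ring
    _ = s + 1 := by rw [h, hs, zero_add, add_comm]

theorem braidSum_comm_of_braid {A : Type*} [Ring A] {s t : A} (h : s * t * s = t * s * t) :
    braidSum s t = braidSum t s := by
  rw [braidSum, braidSum, h]
  abel

theorem braidSum_conj {A : Type*} [Ring A] {g g' s t : A} (hg : g' * g = 1) (hg' : g * g' = 1) :
    braidSum (g * s * g') (g * t * g') = g * braidSum s t * g' := by
  have h (x y : A) : g * x * g' * (g * y * g') = g * (x * y) * g' := by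
    calc _ = g * x * (g' * g) * y * g' := by noncomm_ring
      _ = _ := by rw [hg]; noncomm_ring
  simp only [braidSum, h, mul_add, add_mul, mul_one, hg']

theorem TwoSidedIdeal.mk'_eq_zero_iff {A : Type*} [Ring A] (I : TwoSidedIdeal A) {x : A} :
    I.ringCon.mk' x = 0 ↔ x ∈ I := by
  rw [← TwoSidedIdeal.mem_ker, TwoSidedIdeal.ker_ringCon_mk']

/-- If an algebra homomorphism kills `braidSum` of one pair of consecutive simple transpositions,
then it factors through the Temperley–Lieb algebra. -/
theorem exists_algHom_TLu_of_braidSum_eq_zero {R : Type} [CommRing R] {n : ℕ} {A : Type*}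
    [Ring A] [Algebra R A] (π : SymGrpAlg R n →ₐ[R] A) {i j : Fin (n - 1)}
    (hij : i.val + 1 = j.val)
    (h : π (braidSum (MonoidAlgebra.of R _ (simpleT n i))
      (MonoidAlgebra.of R _ (simpleT n j))) = 0) :
    ∃ ψ : TL R n →ₐ[R] A, ∀ k, ψ (TLu R n k) = π (MonoidAlgebra.of R _ (simpleT n k)) + 1 := by
  let s : Equiv.Perm (Fin n) →* A := (π : SymGrpAlg R n →* A).comp (MonoidAlgebra.of R _)
  have hsq (k : Fin (n - 1)) : s (simpleT n k) * s (simpleT n k) = 1 := by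
    rw [← map_mul, simpleT_mul_self, map_one]
  have hsucc {k l : Fin (n - 1)} (hkl : k.val + 1 = l.val) :
      braidSum (s (simpleT n k)) (s (simpleT n l)) = 0 := by
    obtain ⟨σ, hk, hl⟩ := exists_conj_simpleT hij hkl
    have h' : braidSum (s (simpleT n i)) (s (simpleT n j)) = 0 := by
      rw [map_braidSum] at h
      exact h
    rw [hk, hl, map_mul, map_mul, map_mul, map_mul, braidSum_conj, h', mul_zero, zero_mul]
    · rw [← map_mul, inv_mul_cancel, map_one]
    · rw [← map_mul, mul_inv_cancel, map_one]
  refine exists_algHom_TLu (fun k => s (simpleT n k) + 1) (fun k => ?_) (fun k l hkl => ?_)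
    (fun k l hkl => ?_)
  · calc _ = s (simpleT n k) * s (simpleT n k) + 2 * s (simpleT n k) + 1 := by noncomm_ring
      _ = _ := by rw [hsq]; noncomm_ring
  · refine add_one_mul_mul_of_braidSum_eq_zero (hsq k) ?_
    obtain hkl | hkl : k.val + 1 = l.val ∨ l.val + 1 = k.val := by
      rw [Nat.dist] at hkl
      omega
    · exact hsucc hkl
    · rw [braidSum_comm_of_braid, hsucc hkl]
      rw [← map_mul, ← map_mul, ← simpleT_braid hkl, map_mul, map_mul]
  · have hcomm : simpleT n k * simpleT n l = simpleT n l * simpleT n k := by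
      obtain hkl | hkl : k.val + 1 < l.val ∨ l.val + 1 < k.val := by
        rw [Nat.dist] at hkl
        omega
      · exact simpleT_comm hkl
      · exact (simpleT_comm hkl).symm
    have : Commute (s (simpleT n k)) (s (simpleT n l)) := Commute.map hcomm s
    exact ((this.add_right (Commute.one_right _)).add_left (Commute.one_left _)).eq

theorem ker_eq_span_braidSum {n : ℕ} {Φ : SymGrpAlg ℤ n →ₐ[ℤ] TL ℤ n}
    (hΦ : ∀ i, Φ (MonoidAlgebra.of ℤ _ (simpleT n i)) = TLu ℤ n i - 1) {i j : Fin (n - 1)}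
    (hij : i.val + 1 = j.val) :
    TwoSidedIdeal.ker Φ.toRingHom = TwoSidedIdeal.span
      {braidSum (MonoidAlgebra.of ℤ _ (simpleT n i)) (MonoidAlgebra.of ℤ _ (simpleT n j))} := by
  apply le_antisymm
  · set I := TwoSidedIdeal.span
      {braidSum (MonoidAlgebra.of ℤ _ (simpleT n i)) (MonoidAlgebra.of ℤ _ (simpleT n j))}
    let π : SymGrpAlg ℤ n →ₐ[ℤ] I.ringCon.Quotient := I.ringCon.mk'.toIntAlgHom
    obtain ⟨ψ, hψ⟩ := exists_algHom_TLu_of_braidSum_eq_zero π hij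
      (I.mk'_eq_zero_iff.2 (TwoSidedIdeal.subset_span rfl))
    have hcomp : ψ.comp Φ = π := by
      refine MonoidAlgebra.algHom_ext' (MonoidHom.eq_of_eqOn_denseM (closure_range_simpleT n) ?_)
        (Subsingleton.elim _ _)
      rintro _ ⟨k, rfl⟩
      change ψ (Φ (MonoidAlgebra.of ℤ _ (simpleT n k))) = π (MonoidAlgebra.of ℤ _ (simpleT n k))
      rw [hΦ, map_sub, hψ, map_one, add_sub_cancel_right]
    intro x hx
    have hx' : Φ x = 0 := (TwoSidedIdeal.mem_ker _).1 hx
    refine I.mk'_eq_zero_iff.1 ?_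
    change π x = 0
    rw [← hcomp, AlgHom.comp_apply, hx', map_zero]
  · rw [TwoSidedIdeal.span_le, Set.singleton_subset_iff, SetLike.mem_coe, TwoSidedIdeal.mem_ker]
    change Φ _ = 0
    rw [map_braidSum, hΦ, hΦ]
    exact braidSum_sub_one (TLu_mul_self i) (TLu_braid (by rw [Nat.dist]; omega))

/-- There is a surjective `ℤ`-algebra homomorphism `Φ : ℤ𝔖_n → TL_n`
with `Φ(s_i) = u_i − 1` for every simple transposition `s_i`, `1 ≤ i ≤ n−1`; and for
`n ≥ 3` the kernel of `Φ` is the two-sided ideal of `ℤ𝔖_n` generated by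
`s_1 s_2 s_1 + s_1 s_2 + s_2 s_1 + s_1 + s_2 + 1`. -/
theorem exists_TL_surjection_symmetricGroupAlgebra (n : ℕ) :
    ∃ Φ : SymGrpAlg ℤ n →ₐ[ℤ] TL ℤ n,
      Function.Surjective Φ ∧
      (∀ i : Fin (n - 1),
        Φ (MonoidAlgebra.of ℤ (Equiv.Perm (Fin n)) (simpleT n i)) = TLu ℤ n i - 1) ∧
      (∀ hn : 3 ≤ n,
        letI s₁ : SymGrpAlg ℤ n :=
          MonoidAlgebra.of ℤ (Equiv.Perm (Fin n)) (simpleT n ⟨0, by omega⟩)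
        letI s₂ : SymGrpAlg ℤ n :=
          MonoidAlgebra.of ℤ (Equiv.Perm (Fin n)) (simpleT n ⟨1, by omega⟩)
        TwoSidedIdeal.ker Φ.toRingHom =
          TwoSidedIdeal.span {s₁ * s₂ * s₁ + s₁ * s₂ + s₂ * s₁ + s₁ + s₂ + 1}) := by
  obtain ⟨Φ, hΦ⟩ := exists_algHom_simpleT ℤ n
  exact ⟨Φ, surjective_of_simpleT hΦ, hΦ, fun hn => ker_eq_span_braidSum hΦ rfl⟩
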